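/- (Least Action Principle.) Let ξ be a fixed stack array, η a configuration, and V ⊆ ℤ. If α and β are two toppling sequences legal for η such that β is contained in V and α stabilizes η in V, then h_β ≤ h_α pointwise; that is, every toppling performed in β is also needed in α. -/

import Mathlib

/-!
Activated Random Walk: configurations, stacks, toppling, Abelian property.

Configurations are elements of `Ω = (ℕ ∪ {ρ})^ℤ`; `num n` means `n` active particles,
`rho` a single sleeping particle.  A stack array assigns to each site `x` and each
index `j` an instruction `τ_{x,x-1}`, `τ_{x,x+1}` or `τ_{x,ρ}` (encoded as
`left`, `right`, `sleep`).  Toppling at `x` uses the first unused instruction of the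
stack at `x` (indices start at `0`, i.e. the `(h x + 1)`-st instruction).
-/

/-- The state of a single site: `num n` = `n` active particles, `rho` = one sleeping
particle. -/
inductive ARWState where
  | num : ℕ → ARWState
  | rho : ARWState
deriving DecidableEq

/-- Configurations on `ℤ`. -/
abbrev Config := ℤ → ARWState

/-- Adding one (active) particle to a site: `ρ + 1 = 2`. -/
def ARWState.inc : ARWState → ARWState
  | .num n => .num (n + 1)
  | .rho => .num 2

/-- Removing one active particle from a site (only meaningful at unstable sites). -/
def ARWState.dec : ARWState → ARWState
  | .num (n + 1) => .num n
  | s => s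

/-- The effect of a sleep instruction `τ_{x,ρ}`: `ρ·1 = ρ`, `ρ·n = n` for `n > 1`. -/
def ARWState.toSleep : ARWState → ARWState
  | .num 1 => .rho
  | s => s

/-- A site `x` is unstable in `η` if it carries at least one active particle. -/
def Unstable (η : Config) (x : ℤ) : Prop := ∃ n : ℕ, 1 ≤ n ∧ η x = .num n

/-- The three kinds of instructions at a site `x`: `τ_{x,x-1}`, `τ_{x,x+1}`, `τ_{x,ρ}`. -/
inductive Instr where
  | left : Instr
  | right : Instr
  | sleep : Instr
deriving DecidableEq

/-- The action of an instruction at site `x` on a configuration. -/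
def applyInstr (ι : Instr) (x : ℤ) (η : Config) : Config :=
  match ι with
  | .left => fun z => if z = x then (η x).dec else if z = x - 1 then (η (x - 1)).inc else η z
  | .right => fun z => if z = x then (η x).dec else if z = x + 1 then (η (x + 1)).inc else η z
  | .sleep => fun z => if z = x then (η x).toSleep else η z

/-- A stack array `ξ = (ξ_{(x,j)})`. -/
abbrev Stacks := ℤ → ℕ → Instr

/-- One toppling at `x`, acting on a pair (configuration, odometer): it uses the first
unused instruction `ξ_{(x, h x + 1)}` of the stack at `x` and increases the odometer
at `x` by one. -/
def toppleOne (ξ : Stacks) (x : ℤ) (p : Config × (ℤ → ℕ)) : Config × (ℤ → ℕ) :=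
  (applyInstr (ξ x (p.2 x)) x p.1, Function.update p.2 x (p.2 x + 1))

/-- Toppling along a finite sequence `α = (x₁, …, x_k)`, i.e. `Φ_α = Φ_{x_k} ∘ ⋯ ∘ Φ_{x_1}`. -/
def toppleSeq (ξ : Stacks) : List ℤ → Config × (ℤ → ℕ) → Config × (ℤ → ℕ)
  | [], p => p
  | x :: α, p => toppleSeq ξ α (toppleOne ξ x p)

/-- Legality of a toppling sequence: each successive toppling happens at a site that is
unstable in the configuration at that stage. -/
def LegalFrom (ξ : Stacks) : List ℤ → Config × (ℤ → ℕ) → Prop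
  | [], _ => True
  | x :: α, p => Unstable p.1 x ∧ LegalFrom ξ α (toppleOne ξ x p)

/-- `Φ_α(η)`: the configuration resulting from toppling the sequence `α` starting from `η`
(and odometer `0`). -/
def topple (ξ : Stacks) (α : List ℤ) (η : Config) : Config :=
  (toppleSeq ξ α (η, fun _ => 0)).1

/-- `α` is a legal toppling sequence for `η` (with fresh stacks). -/
def LegalSeq (ξ : Stacks) (α : List ℤ) (η : Config) : Prop :=
  LegalFrom ξ α (η, fun _ => 0)

/-- A toppling sequence is contained in `V` if all its entries lie in `V`. -/
def ContainedIn (α : List ℤ) (V : Set ℤ) : Prop := ∀ x ∈ α, x ∈ V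

/-- `α` stabilizes `η` in `V` if every site of `V` is stable in `Φ_α(η)`. -/
def StabilizesIn (ξ : Stacks) (α : List ℤ) (η : Config) (V : Set ℤ) : Prop :=
  ∀ x ∈ V, ¬ Unstable (topple ξ α η) x

theorem lap_unst {ξ : Stacks} {x y : ℤ} (hxy : x ≠ y) (p : Config × (ℤ → ℕ))
    (hx : Unstable p.1 x) : Unstable (toppleOne ξ y p).1 x := by
  obtain ⟨n, hn, h⟩ := hx
  simp only [toppleOne, Unstable]
  cases ξ y (p.2 y) <;> simp only [applyInstr, if_neg hxy]
  · split_ifs with h1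
    · subst h1; exact ⟨n + 1, by omega, by rw [h]; rfl⟩
    · exact ⟨n, hn, h⟩
  · split_ifs with h1
    · subst h1; exact ⟨n + 1, by omega, by rw [h]; rfl⟩
    · exact ⟨n, hn, h⟩
  · exact ⟨n, hn, h⟩

theorem lap_dec_inc (n : ℕ) : (ARWState.num (n+1)).dec.inc = (ARWState.num (n+1)).inc.dec := rfl

theorem lap_sleep_inc (n : ℕ) :
    (ARWState.num (n+1)).toSleep.inc = (ARWState.num (n+1)).inc.toSleep := by
  cases n <;> rfl

theorem lap_comm_instr (a b : Instr) {x y : ℤ} (hxy : x ≠ y) (η : Config)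
    (hx : Unstable η x) (hy : Unstable η y) :
    applyInstr a x (applyInstr b y η) = applyInstr b y (applyInstr a x η) := by
  obtain ⟨n, hn, h⟩ := hx
  obtain ⟨m, hm, h'⟩ := hy
  obtain ⟨n, rfl⟩ := Nat.exists_eq_add_of_le' hn
  obtain ⟨m, rfl⟩ := Nat.exists_eq_add_of_le' hm
  have e1 := lap_dec_inc n
  have e2 := lap_sleep_inc n
  have e3 := lap_dec_inc m
  have e4 := lap_sleep_inc m
  rw [← h] at e1 e2
  rw [← h'] at e3 e4
  funext z
  cases a <;> cases b <;> simp only [applyInstr] <;> grind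

theorem lap_comm {ξ : Stacks} {x y : ℤ} (hxy : x ≠ y) (p : Config × (ℤ → ℕ))
    (hx : Unstable p.1 x) (hy : Unstable p.1 y) :
    toppleOne ξ x (toppleOne ξ y p) = toppleOne ξ y (toppleOne ξ x p) := by
  simp only [toppleOne, Function.update_of_ne hxy, Function.update_of_ne hxy.symm]
  rw [lap_comm_instr _ _ hxy _ hx hy, Function.update_comm hxy]

theorem lap_mem {ξ : Stacks} {x : ℤ} (α : List ℤ) : ∀ p : Config × (ℤ → ℕ),
    Unstable p.1 x → ¬ Unstable (toppleSeq ξ α p).1 x → x ∈ α := by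
  induction α with
  | nil => intro p h h'; exact absurd h h'
  | cons y α ih =>
    intro p h h'
    by_cases hxy : x = y
    · simp [hxy]
    · exact List.mem_cons_of_mem _ (ih _ (lap_unst hxy p h) h')

theorem lap_move {ξ : Stacks} {x : ℤ} (α : List ℤ) : ∀ p : Config × (ℤ → ℕ),
    Unstable p.1 x → LegalFrom ξ α p → x ∈ α →
    LegalFrom ξ (α.erase x) (toppleOne ξ x p) ∧
      toppleSeq ξ (α.erase x) (toppleOne ξ x p) = toppleSeq ξ α p := by
  induction α with
  | nil => intro p _ _ h; simp at h
  | cons y α ih =>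
    intro p h hl hm
    by_cases hxy : x = y
    · subst hxy
      rw [List.erase_cons_head]
      exact ⟨hl.2, rfl⟩
    · have hm' : x ∈ α := by simpa [hxy] using hm
      obtain ⟨i1, i2⟩ := ih _ (lap_unst hxy p h) hl.2 hm'
      rw [List.erase_cons_tail (by simpa using Ne.symm hxy)]
      rw [lap_comm hxy p h hl.1] at i1 i2
      exact ⟨⟨lap_unst (Ne.symm hxy) p hl.1, i1⟩, i2⟩

theorem lap_main (ξ : Stacks) (V : Set ℤ) (β : List ℤ) : ∀ (α : List ℤ) (p : Config × (ℤ → ℕ)),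
    LegalFrom ξ β p → (∀ x ∈ β, x ∈ V) → LegalFrom ξ α p →
    (∀ x ∈ V, ¬ Unstable (toppleSeq ξ α p).1 x) → ∀ x : ℤ, β.count x ≤ α.count x := by
  induction β with
  | nil => intros; simp
  | cons y β ih =>
    intro α p hb hV ha hs x
    have hm := lap_mem α p hb.1 (hs y (hV y (by simp)))
    obtain ⟨h1, h2⟩ := lap_move α p hb.1 ha hm
    have := ih (α.erase y) _ hb.2 (fun x hx => hV x (by simp [hx])) h1 (by rwa [h2]) x
    rw [(List.perm_cons_erase hm).count_eq x, List.count_cons, List.count_cons]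
    omega

/-- **Least Action Principle.**  If `β` is a legal toppling sequence for `η` contained in `V`
and `α` is a legal toppling sequence for `η` that stabilizes `η` in `V`, then `h_β ≤ h_α`
pointwise: every toppling performed in `β` is also needed in `α`. -/
theorem least_action_principle (ξ : Stacks) (η : Config) (V : Set ℤ) (α β : List ℤ)
    (hβleg : LegalSeq ξ β η) (hβV : ContainedIn β V)
    (hαleg : LegalSeq ξ α η) (hαstab : StabilizesIn ξ α η V) :
    ∀ x : ℤ, β.count x ≤ α.count x := by
  exact lap_main ξ V β α _ hβleg hβV hαleg hαstab
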